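/- Let G be a finite non-cyclic group that is generated by two elements, and let m ≥ 2 be an integer. Then G has an oriented m-semiregular representation (OmSR) of valency two, except when m = 2 and G is isomorphic to Z_2 × Z_2. -/

import Mathlib

/-- The arc relation of the `m`-Cayley digraph `Cay(G, T_{i,j} : i,j ∈ Z_m)`:
there is an arc from `(g,i)` to `(t*g, j)` for each `t ∈ T i j`. -/
def mCayleyArc {G : Type*} [Group G] {m : ℕ} (T : ZMod m → ZMod m → Set G) :
    G × ZMod m → G × ZMod m → Prop :=
  fun x y => ∃ t ∈ T x.2 y.2, y.1 = t * x.1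

/-- A permutation `σ` of the vertex set is an automorphism of the digraph with
arc relation `A` if it preserves the arc relation. -/
def IsDigraphAuto {V : Type*} (A : V → V → Prop) (σ : Equiv.Perm V) : Prop :=
  ∀ x y : V, A (σ x) (σ y) ↔ A x y

/-- A digraph is oriented if there are no loops and no pair of oppositely
directed arcs between any two vertices. -/
def IsOrientedRel {V : Type*} (A : V → V → Prop) : Prop :=
  ∀ x y : V, A x y → ¬ A y x

/-- The right translation `R(h) : (g,i) ↦ (g*h, i)` on the vertex set `G × Z_m`. -/
def rightTransl {G : Type*} [Group G] (m : ℕ) (h : G) : Equiv.Perm (G × ZMod m) :=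
  (Equiv.mulRight h).prodCongr (Equiv.refl (ZMod m))

/-- `G` admits an oriented `m`-semiregular representation (OmSR) of valency two:
there are connection sets `T i j ⊆ G` such that the corresponding `m`-Cayley
digraph is oriented, every vertex has exactly two out-neighbours and exactly two
in-neighbours, and the full automorphism group consists exactly of the right
translations `R(h)`, `h ∈ G`. -/
def HasOmSRValencyTwo (G : Type*) [Group G] (m : ℕ) : Prop :=
  ∃ T : ZMod m → ZMod m → Set G,
    IsOrientedRel (mCayleyArc T) ∧
    (∀ x : G × ZMod m, {y | mCayleyArc T x y}.ncard = 2) ∧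
    (∀ x : G × ZMod m, {y | mCayleyArc T y x}.ncard = 2) ∧
    (∀ σ : Equiv.Perm (G × ZMod m),
      IsDigraphAuto (mCayleyArc T) σ ↔ ∃ h : G, σ = rightTransl m h)

/-- The connection sets of the digraph with arcs `(g,i) → (τ i * g, i+1)` and
`(g,i) → (β i * g, i+2)`. -/
def twoStepSets {G : Type*} {m : ℕ} (τ β : ZMod m → G) (i j : ZMod m) : Set G :=
  {t | (j = i + 1 ∧ t = τ i) ∨ (j = i + 2 ∧ t = β i)}

/-- The permutation `(g,i) ↦ (f i * g, i+k)` of `G × ZMod m`. -/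
def layerStep {G : Type*} [Group G] {m : ℕ} (f : ZMod m → G) (k : ZMod m) :
    Equiv.Perm (G × ZMod m) where
  toFun x := (f x.2 * x.1, x.2 + k)
  invFun y := ((f (y.2 - k))⁻¹ * y.1, y.2 - k)
  left_inv x := by simp
  right_inv y := by simp

/-- Forward voltages: trivial except for `b` on the arcs closing up the cycle of layers. -/
def wrapVoltage {G : Type*} [One G] {m : ℕ} (b : G) (i : ZMod m) : G :=
  if i = -1 then b else 1

/-- Voltages on the arcs of step two making `(g,i) → F → B` a transitive triangle exactly when
`i ≠ -1`. -/
def skipVoltage {G : Type*} [One G] {m : ℕ} (a b : G) (i : ZMod m) : G :=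
  if i = -1 then a else if i = -2 then b else 1

section TwoStep

variable {G : Type*} [Group G] {m : ℕ}

theorem layerStep_apply (f : ZMod m → G) (k : ZMod m) (x : G × ZMod m) :
    layerStep f k x = (f x.2 * x.1, x.2 + k) := rfl

theorem mCayleyArc_twoStepSets {τ β : ZMod m → G} {x y : G × ZMod m} :
    mCayleyArc (twoStepSets τ β) x y ↔ y = layerStep τ 1 x ∨ y = layerStep β 2 x := by
  obtain ⟨g, i⟩ := x
  obtain ⟨h, j⟩ := y
  simp only [mCayleyArc, twoStepSets, Set.mem_ofPred_eq, layerStep_apply, Prod.mk.injEq]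
  constructor
  · rintro ⟨t, ⟨rfl, rfl⟩ | ⟨rfl, rfl⟩, rfl⟩ <;> simp
  · rintro (⟨rfl, rfl⟩ | ⟨rfl, rfl⟩)
    · exact ⟨_, Or.inl ⟨rfl, rfl⟩, rfl⟩
    · exact ⟨_, Or.inr ⟨rfl, rfl⟩, rfl⟩

theorem zmod_natCast_ne_zero_of_lt {k : ℕ} (hk : 0 < k) (hkm : k < m) : (k : ZMod m) ≠ 0 := by
  rw [Ne, ZMod.natCast_eq_zero_iff]
  exact fun h => absurd (Nat.le_of_dvd hk h) (by omega)

theorem one_ne_zero_zmod (hm : 2 ≤ m) : (1 : ZMod m) ≠ 0 := by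
  simpa using zmod_natCast_ne_zero_of_lt (m := m) one_pos (by omega)

theorem ncard_out_twoStep (hm : 2 ≤ m) (τ β : ZMod m → G) (x : G × ZMod m) :
    {y | mCayleyArc (twoStepSets τ β) x y}.ncard = 2 := by
  have hset : {y | mCayleyArc (twoStepSets τ β) x y} = {layerStep τ 1 x, layerStep β 2 x} := by
    ext y
    simp [mCayleyArc_twoStepSets]
  rw [hset, Set.ncard_pair]
  intro h
  have h2 := congrArg Prod.snd h
  simp only [layerStep_apply] at h2
  exact one_ne_zero_zmod hm (by linear_combination -h2)

theorem ncard_in_twoStep (hm : 2 ≤ m) (τ β : ZMod m → G) (x : G × ZMod m) :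
    {y | mCayleyArc (twoStepSets τ β) y x}.ncard = 2 := by
  have hset : {y | mCayleyArc (twoStepSets τ β) y x} =
      {(layerStep τ 1).symm x, (layerStep β 2).symm x} := by
    ext y
    simp [mCayleyArc_twoStepSets, Equiv.eq_symm_apply, eq_comm]
  rw [hset, Set.ncard_pair]
  intro h
  have h2 : x.2 - 1 = x.2 - 2 := congrArg Prod.snd h
  exact one_ne_zero_zmod hm (by linear_combination h2)

theorem rightTransl_layerStep (f : ZMod m → G) (k : ZMod m) (h : G) (x : G × ZMod m) :
    rightTransl m h (layerStep f k x) = layerStep f k (rightTransl m h x) := by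
  simp [rightTransl, layerStep_apply, mul_assoc]

theorem isDigraphAuto_rightTransl (τ β : ZMod m → G) (h : G) :
    IsDigraphAuto (mCayleyArc (twoStepSets τ β)) (rightTransl m h) := by
  intro x y
  simp [mCayleyArc_twoStepSets, ← rightTransl_layerStep]

theorem IsDigraphAuto.symm {V : Type*} {A : V → V → Prop} {σ : Equiv.Perm V}
    (hσ : IsDigraphAuto A σ) : IsDigraphAuto A σ.symm := by
  intro x y
  simpa using (hσ (σ.symm x) (σ.symm y)).symm

/-- A set of vertices stable under both kinds of arcs in both directions is everything, as soon
as it is non-empty and the voltages generate the group. -/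
theorem mem_of_stable [NeZero m] {a b : G} (hgen : Subgroup.closure {a, b} = ⊤) {β : ZMod m → G}
    {k : ZMod m} (hk : β k = a) {S : Set (G × ZMod m)}
    (hF : ∀ x, layerStep (wrapVoltage b) 1 x ∈ S ↔ x ∈ S)
    (hB : ∀ x, layerStep β 2 x ∈ S ↔ x ∈ S) (h1 : ((1 : G), (0 : ZMod m)) ∈ S)
    (x : G × ZMod m) : x ∈ S := by
  have hnat : ∀ n : ℕ, n < m → ∀ g : G, (g, (n : ZMod m)) ∈ S ↔ (g, (0 : ZMod m)) ∈ S := by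
    intro n
    induction n with
    | zero => simp
    | succ n ih =>
      intro hn g
      have hne : (n : ZMod m) ≠ -1 := by
        intro h
        refine zmod_natCast_ne_zero_of_lt (m := m) (Nat.succ_pos n) hn ?_
        push_cast
        linear_combination h
      have := hF (g, (n : ZMod m))
      rw [layerStep_apply] at this
      simp only [wrapVoltage, hne, if_false, one_mul] at this
      rw [← ih (by omega) g, ← this]
      push_cast
      rfl
  have hzero : ∀ (g : G) (i : ZMod m), (g, i) ∈ S ↔ (g, (0 : ZMod m)) ∈ S := by
    intro g i
    simpa using hnat i.val (ZMod.val_lt i) g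
  have hb : ∀ g : G, (b * g, (0 : ZMod m)) ∈ S ↔ (g, (0 : ZMod m)) ∈ S := by
    intro g
    have := hF (g, -1)
    rw [layerStep_apply, hzero, hzero g] at this
    simpa [wrapVoltage] using this
  have ha : ∀ g : G, (a * g, (0 : ZMod m)) ∈ S ↔ (g, (0 : ZMod m)) ∈ S := by
    intro g
    have := hB (g, k)
    rw [layerStep_apply, hzero, hzero g] at this
    simpa [hk] using this
  have hall : ∀ t : G, ∀ g : G, (t * g, (0 : ZMod m)) ∈ S ↔ (g, (0 : ZMod m)) ∈ S := by
    intro t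
    have ht : t ∈ Subgroup.closure {a, b} := hgen ▸ Subgroup.mem_top t
    induction ht using Subgroup.closure_induction with
    | mem t ht =>
      rcases ht with rfl | rfl
      · exact ha
      · exact hb
    | one => simp
    | mul s t _ _ hs ht => intro g; rw [mul_assoc, hs, ht]
    | inv t _ ht => intro g; simpa using (ht (t⁻¹ * g)).symm
  obtain ⟨g, i⟩ := x
  rw [hzero]
  simpa using (hall g 1).2 h1

theorem hasOmSRValencyTwo_of_layers (hm : 2 ≤ m) {a b : G}
    (hgen : Subgroup.closure {a, b} = ⊤) {β : ZMod m → G} {k : ZMod m} (hk : β k = a)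
    (hor : IsOrientedRel (mCayleyArc (twoStepSets (wrapVoltage b) β)))
    (hlay : ∀ σ : Equiv.Perm (G × ZMod m),
      IsDigraphAuto (mCayleyArc (twoStepSets (wrapVoltage b) β)) σ → ∀ x, (σ x).2 = x.2) :
    HasOmSRValencyTwo G m := by
  have : NeZero m := ⟨by omega⟩
  refine ⟨_, hor, ncard_out_twoStep hm _ _, ncard_in_twoStep hm _ _, fun σ => ⟨fun hσ => ?_, ?_⟩⟩
  · have hl := hlay σ hσ
    have hne := one_ne_zero_zmod hm
    have hF : ∀ x, σ (layerStep (wrapVoltage b) 1 x) = layerStep (wrapVoltage b) 1 (σ x) := by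
      intro x
      have h := (hσ x _).2 (mCayleyArc_twoStepSets.2 (Or.inl rfl))
      refine (mCayleyArc_twoStepSets.1 h).resolve_right fun h' => hne ?_
      have h2 := congrArg Prod.snd h'
      rw [hl] at h2
      simp only [layerStep_apply, hl] at h2
      linear_combination -h2
    have hB : ∀ x, σ (layerStep β 2 x) = layerStep β 2 (σ x) := by
      intro x
      have h := (hσ x _).2 (mCayleyArc_twoStepSets.2 (Or.inr rfl))
      refine (mCayleyArc_twoStepSets.1 h).resolve_left fun h' => hne ?_
      have h2 := congrArg Prod.snd h'
      rw [hl] at h2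
      simp only [layerStep_apply, hl] at h2
      linear_combination h2
    refine ⟨(σ (1, 0)).1, Equiv.ext fun x => ?_⟩
    refine mem_of_stable hgen hk (S := {x | σ x = rightTransl m (σ (1, 0)).1 x}) ?_ ?_ ?_ x
    · intro x
      simp [hF, rightTransl_layerStep]
    · intro x
      simp [hB, rightTransl_layerStep]
    · ext
      · simp [rightTransl]
      · simp [rightTransl, hl]
  · rintro ⟨h, rfl⟩
    exact isDigraphAuto_rightTransl _ _ h

theorem eq_two_of_two_eq_zero (hm : 2 ≤ m) (h : (2 : ZMod m) = 0) : m = 2 :=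
  le_antisymm (Nat.le_of_dvd two_pos ((ZMod.natCast_eq_zero_iff 2 m).1 (by exact_mod_cast h))) hm

theorem eq_three_of_three_eq_zero (hm : 2 ≤ m) (h : (3 : ZMod m) = 0) : m = 3 :=
  ((Nat.dvd_prime Nat.prime_three).1
    ((ZMod.natCast_eq_zero_iff 3 m).1 (by exact_mod_cast h))).resolve_left (by omega)

theorem eq_two_or_four_of_four_eq_zero (hm : 2 ≤ m) (h : (4 : ZMod m) = 0) : m = 2 ∨ m = 4 := by
  have hd : m ∣ 4 := (ZMod.natCast_eq_zero_iff 4 m).1 (by exact_mod_cast h)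
  have hle := Nat.le_of_dvd (by norm_num) hd
  interval_cases m <;> omega

theorem zmod_two_cases (i : ZMod 2) : i = 0 ∨ i = 1 := by
  revert i
  decide

theorem zmod_three_cases (i : ZMod 3) : i = 0 ∨ i = 1 ∨ i = 2 := by
  revert i
  decide

theorem zmod_four_cases (i : ZMod 4) : i = 0 ∨ i = 1 ∨ i = 2 ∨ i = 3 := by
  revert i
  decide

theorem skipVoltage_ne_one {a b : G} (ha : a ≠ 1) (hb : b ≠ 1) (i : ZMod 2) :
    skipVoltage a b i ≠ 1 := by
  rcases zmod_two_cases i with rfl | rfl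
  · exact hb
  · exact ha

theorem forward_forward_eq_skip_iff (hm : 2 ≤ m) {a b : G} (hab : a ≠ b) (x : G × ZMod m) :
    layerStep (wrapVoltage b) 1 (layerStep (wrapVoltage b) 1 x) =
      layerStep (skipVoltage a b) 2 x ↔ x.2 ≠ -1 := by
  have hne := one_ne_zero_zmod hm
  obtain ⟨g, i⟩ := x
  have hadd : i + 1 + 1 = i + 2 := by ring
  by_cases hi : i = -1
  · subst hi
    have h0 : (0 : ZMod m) ≠ -1 := fun h => hne (by linear_combination h)
    simp [layerStep_apply, wrapVoltage, skipVoltage, h0, hab.symm]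
  · have hiff : i + 1 = -1 ↔ i = -2 :=
      ⟨fun h => by linear_combination h, fun h => by linear_combination h⟩
    simp [layerStep_apply, wrapVoltage, skipVoltage, hi, hiff, hadd]

theorem transitive_triangle_iff (hm : 2 ≤ m) {a b : G} (ha : a ≠ 1) (hb : b ≠ 1) (hab : a ≠ b)
    {x u v : G × ZMod m} :
    (mCayleyArc (twoStepSets (wrapVoltage b) (skipVoltage a b)) x u ∧
      mCayleyArc (twoStepSets (wrapVoltage b) (skipVoltage a b)) u v ∧
      mCayleyArc (twoStepSets (wrapVoltage b) (skipVoltage a b)) x v) ↔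
    x.2 ≠ -1 ∧ u = layerStep (wrapVoltage b) 1 x ∧ v = layerStep (skipVoltage a b) 2 x := by
  have hne := one_ne_zero_zmod hm
  simp only [mCayleyArc_twoStepSets]
  constructor
  · rintro ⟨rfl | rfl, rfl | rfl, h | h⟩
    · exact absurd (congrArg Prod.snd h) fun h2 => hne (by
        simp only [layerStep_apply] at h2
        linear_combination h2)
    · exact ⟨(forward_forward_eq_skip_iff hm hab x).1 h, rfl, h⟩
    all_goals
      exfalso
      obtain ⟨g, i⟩ := x
      simp only [layerStep_apply, Prod.mk.injEq] at h
      obtain ⟨h1, h2⟩ := h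
    · obtain rfl := eq_two_of_two_eq_zero hm (by linear_combination h2)
      exact skipVoltage_ne_one ha hb _ (mul_eq_right.1 h1)
    · exact hne (by linear_combination h2)
    · obtain rfl := eq_two_of_two_eq_zero hm (by linear_combination h2)
      have hi : i + 2 = i := by linear_combination h2
      rw [hi] at h1
      exact skipVoltage_ne_one ha hb _ (mul_eq_right.1 (mul_left_cancel h1))
    · exact hne (by linear_combination h2)
    · obtain rfl := eq_three_of_three_eq_zero hm (by linear_combination h2)
      rw [← mul_assoc] at h1
      replace h1 := mul_right_cancel h1
      rcases zmod_three_cases i with rfl | rfl | rfl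
      · change a * 1 = 1 at h1
        exact ha (by simpa using h1)
      · change 1 * b = 1 at h1
        exact hb (by simpa using h1)
      · change b * a = b at h1
        exact ha (by simpa using h1)
    · obtain rfl := eq_two_of_two_eq_zero hm (by linear_combination h2)
      exact skipVoltage_ne_one ha hb _ (mul_eq_right.1 h1)
  · rintro ⟨hi, rfl, rfl⟩
    exact ⟨Or.inl rfl, Or.inl ((forward_forward_eq_skip_iff hm hab x).2 hi).symm, Or.inr rfl⟩

theorem snd_apply_of_isDigraphAuto (hm : 2 ≤ m) {a b : G} (ha : a ≠ 1) (hb : b ≠ 1)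
    (hab : a ≠ b) {σ : Equiv.Perm (G × ZMod m)}
    (hσ : IsDigraphAuto (mCayleyArc (twoStepSets (wrapVoltage b) (skipVoltage a b))) σ)
    (x : G × ZMod m) : (σ x).2 = x.2 := by
  have : NeZero m := ⟨by omega⟩
  have hmap : ∀ ρ : Equiv.Perm (G × ZMod m),
      IsDigraphAuto (mCayleyArc (twoStepSets (wrapVoltage b) (skipVoltage a b))) ρ →
      ∀ x : G × ZMod m, x.2 ≠ -1 → (ρ x).2 ≠ -1 ∧
        ρ (layerStep (wrapVoltage b) 1 x) = layerStep (wrapVoltage b) 1 (ρ x) := by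
    intro ρ hρ x hx
    obtain ⟨h1, h2, h3⟩ := (transitive_triangle_iff hm ha hb hab).2 ⟨hx, rfl, rfl⟩
    obtain ⟨h, h', -⟩ := (transitive_triangle_iff hm ha hb hab).1
      ⟨(hρ _ _).2 h1, (hρ _ _).2 h2, (hρ _ _).2 h3⟩
    exact ⟨h, h'⟩
  have hdown : ∀ n : ℕ, n < m → ∀ x : G × ZMod m, x.2 = -1 - (n : ZMod m) →
      (σ x).2 = -1 - (n : ZMod m) := by
    intro n
    induction n with
    | zero =>
      intro _ x hx
      simp only [Nat.cast_zero, sub_zero] at hx ⊢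
      by_contra hne
      exact (hmap σ.symm hσ.symm (σ x) hne).1 (by simpa using hx)
    | succ n ih =>
      intro hn x hx
      have hx' : x.2 ≠ -1 := by
        intro h
        refine zmod_natCast_ne_zero_of_lt (m := m) (Nat.succ_pos n) hn ?_
        push_cast at hx ⊢
        linear_combination hx - h
      have hlayer := ih (by omega) (layerStep (wrapVoltage b) 1 x) (by
        simp only [layerStep_apply, hx]
        push_cast
        ring)
      rw [(hmap σ hσ x hx').2] at hlayer
      simp only [layerStep_apply] at hlayer
      push_cast
      linear_combination hlayer
  have hx : x.2 = -1 - (((-1 - x.2).val : ℕ) : ZMod m) := by simp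
  rw [hdown _ (ZMod.val_lt _) x hx, ← hx]

theorem isOrientedRel_skip (hm : 2 ≤ m) {a b : G} (ha : a ≠ 1) (hb : b ≠ 1)
    (hm2 : m = 2 → a * a ≠ 1 ∧ b * b ≠ 1) :
    IsOrientedRel (mCayleyArc (twoStepSets (m := m) (wrapVoltage b) (skipVoltage a b))) := by
  have key : ∀ i : ZMod m, (3 : ZMod m) = 0 →
      (skipVoltage a b (i + 1) * wrapVoltage b i ≠ 1 ∧
        wrapVoltage b (i + 2) * skipVoltage a b i ≠ 1) := by
    intro i h
    obtain rfl := eq_three_of_three_eq_zero hm h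
    rcases zmod_three_cases i with rfl | rfl | rfl
    · change b * 1 ≠ 1 ∧ b * 1 ≠ 1
      simpa using hb
    · change a * 1 ≠ 1 ∧ 1 * b ≠ 1
      simpa using ⟨ha, hb⟩
    · change 1 * b ≠ 1 ∧ 1 * a ≠ 1
      simpa using ⟨hb, ha⟩
  have key' : ∀ i : ZMod m, (4 : ZMod m) = 0 →
      skipVoltage a b (i + 2) * skipVoltage a b i ≠ 1 := by
    intro i h
    obtain rfl | rfl := eq_two_or_four_of_four_eq_zero hm h
    · rcases zmod_two_cases i with rfl | rfl
      · exact (hm2 rfl).2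
      · exact (hm2 rfl).1
    · rcases zmod_four_cases i with rfl | rfl | rfl | rfl
      · change b * 1 ≠ 1
        simpa using hb
      · change a * 1 ≠ 1
        simpa using ha
      · change 1 * b ≠ 1
        simpa using hb
      · change 1 * a ≠ 1
        simpa using ha
  rintro ⟨g, i⟩ y hxy hyx
  rw [mCayleyArc_twoStepSets] at hxy hyx
  rcases hxy with rfl | rfl <;> rcases hyx with h | h <;>
    simp only [layerStep_apply, Prod.mk.injEq, ← mul_assoc, right_eq_mul] at h <;>
    obtain ⟨h1, h2⟩ := h
  · obtain rfl := eq_two_of_two_eq_zero hm (by linear_combination -h2)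
    rcases zmod_two_cases i with rfl | rfl
    · change b * 1 = 1 at h1
      exact hb (by simpa using h1)
    · change 1 * b = 1 at h1
      exact hb (by simpa using h1)
  · exact (key i (by linear_combination -h2)).1 h1
  · exact (key i (by linear_combination -h2)).2 h1
  · exact key' i (by linear_combination -h2) h1

theorem hasOmSRValencyTwo_of_generators (hm : 2 ≤ m) {a b : G}
    (hgen : Subgroup.closure {a, b} = ⊤) (ha : a ≠ 1) (hb : b ≠ 1) (hab : a ≠ b)
    (hm2 : m = 2 → a * a ≠ 1 ∧ b * b ≠ 1) : HasOmSRValencyTwo G m :=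
  hasOmSRValencyTwo_of_layers hm hgen (k := -1) (by simp [skipVoltage])
    (isOrientedRel_skip hm ha hb hm2)
    fun _ hσ => snd_apply_of_isDigraphAuto hm ha hb hab hσ

end TwoStep

section TwoLayers

variable {G : Type*} [Group G]

/-- For `m = 2`, a vertex lies in layer `0` exactly when its two out-neighbours have a common
out-neighbour. -/
theorem exists_diamond_iff {a b : G} (hcomm : a * b ≠ b * a)
    (x : G × ZMod 2) :
    (∃ u v w, u ≠ v ∧ mCayleyArc (twoStepSets (wrapVoltage b) fun _ => a) x u ∧
      mCayleyArc (twoStepSets (wrapVoltage b) fun _ => a) x v ∧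
      mCayleyArc (twoStepSets (wrapVoltage b) fun _ => a) u w ∧
      mCayleyArc (twoStepSets (wrapVoltage b) fun _ => a) v w) ↔ x.2 = 0 := by
  have e1 : (1 : ZMod 2) = -1 := by decide
  have e2 : (2 : ZMod 2) = 0 := by decide
  have e3 : (1 : ZMod 2) + 1 = 0 := by decide
  have hbaa : b ≠ a * a := by
    rintro rfl
    exact hcomm (mul_assoc a a a).symm
  simp only [mCayleyArc_twoStepSets]
  obtain ⟨g, i⟩ := x
  rcases zmod_two_cases i with rfl | rfl
  · simp only [iff_true]
    refine ⟨_, _, _, ?_, Or.inl rfl, Or.inr rfl, Or.inr rfl, Or.inl ?_⟩ <;>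
      simp [layerStep_apply, wrapVoltage, e2]
  · have hstep : ∀ w, ¬ ((w = layerStep (wrapVoltage b) 1 (layerStep (wrapVoltage b) 1 (g, 1)) ∨
          w = layerStep (fun _ => a) 2 (layerStep (wrapVoltage b) 1 (g, (1 : ZMod 2)))) ∧
        (w = layerStep (wrapVoltage b) 1 (layerStep (fun _ => a) 2 (g, 1)) ∨
          w = layerStep (fun _ => a) 2 (layerStep (fun _ => a) 2 (g, (1 : ZMod 2))))) := by
      rintro w ⟨rfl | rfl, h | h⟩ <;>
        simp [layerStep_apply, wrapVoltage, e2, e3, ← e1, ← mul_assoc, hbaa, hcomm] at h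
    simp only [one_ne_zero, iff_false]
    rintro ⟨u, v, w, huv, rfl | rfl, rfl | rfl, hu, hv⟩
    · exact huv rfl
    · exact hstep w ⟨hu, hv⟩
    · exact hstep w ⟨hv, hu⟩
    · exact huv rfl

theorem hasOmSRValencyTwo_two_of_not_commute {a b : G}
    (hgen : Subgroup.closure {a, b} = ⊤) (ha : a * a ≠ 1) (hcomm : a * b ≠ b * a) :
    HasOmSRValencyTwo G 2 := by
  have hb : b ≠ 1 := by
    rintro rfl
    simp at hcomm
  have e1 : (1 : ZMod 2) = -1 := by decide
  have e2 : (2 : ZMod 2) = 0 := by decide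
  have e3 : (1 : ZMod 2) + 1 = 0 := by decide
  refine hasOmSRValencyTwo_of_layers le_rfl hgen (β := fun _ => a) (k := 0) rfl ?_ ?_
  · rintro ⟨g, i⟩ y hxy hyx
    rw [mCayleyArc_twoStepSets] at hxy hyx
    rcases zmod_two_cases i with rfl | rfl <;> rcases hxy with rfl | rfl <;>
      rcases hyx with h | h <;>
      simp [layerStep_apply, wrapVoltage, e2, e3, ← e1, ← mul_assoc, hb, ha] at h
  · intro σ hσ x
    have hzero : (σ x).2 = 0 ↔ x.2 = 0 := by
      rw [← exists_diamond_iff hcomm, ← exists_diamond_iff hcomm]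
      constructor
      · rintro ⟨u, v, w, huv, h1, h2, h3, h4⟩
        refine ⟨σ.symm u, σ.symm v, σ.symm w, by simpa using huv, ?_⟩
        simp only [← hσ _ (σ.symm _), Equiv.apply_symm_apply]
        exact ⟨h1, h2, h3, h4⟩
      · rintro ⟨u, v, w, huv, h1, h2, h3, h4⟩
        exact ⟨σ u, σ v, σ w, by simpa using huv, (hσ _ _).2 h1, (hσ _ _).2 h2,
          (hσ _ _).2 h3, (hσ _ _).2 h4⟩
    generalize (σ x).2 = p at hzero ⊢
    generalize x.2 = q at hzero ⊢
    revert p q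
    decide

/-- In a Klein four-group every candidate for `m = 2` joins the layers by complementary sets of
size two, so multiplying one layer by a suitable involution is an extra automorphism. -/
theorem not_hasOmSRValencyTwo_two (e : G ≃* Multiplicative (ZMod 2 × ZMod 2)) :
    ¬ HasOmSRValencyTwo G 2 := by
  have hsq : ∀ g : G, g * g = 1 := by
    have h : ∀ x : Multiplicative (ZMod 2 × ZMod 2), x * x = 1 := by decide
    intro g
    apply e.injective
    rw [map_mul, h, map_one]
  have hcomm : ∀ g h : G, g * h = h * g := by
    intro g h
    apply e.injective
    rw [map_mul, map_mul, mul_comm]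
  have hcard : Nat.card G = 4 := by
    rw [Nat.card_congr e.toEquiv]
    simp
  have : Finite G := Nat.finite_of_card_ne_zero (by omega)
  rintro ⟨T, hor, hout, -, haut⟩
  have harc : ∀ (g h : G) (i j : ZMod 2), mCayleyArc T (g, i) (h, j) ↔ h * g ∈ T i j := by
    intro g h i j
    constructor
    · rintro ⟨t, ht, rfl : h = t * g⟩
      rwa [mul_assoc, hsq, mul_one]
    · intro ht
      exact ⟨_, ht, by simp [mul_assoc, hsq]⟩
  have hloop : ∀ (i : ZMod 2) (g : G), g ∉ T i i := by
    intro i g hg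
    refine hor (1, i) (g, i) ((harc _ _ _ _).2 (by simpa using hg)) ((harc _ _ _ _).2 ?_)
    simpa using hg
  have hncard : ∀ i : ZMod 2, (T i (i + 1)).ncard = 2 := by
    intro i
    refine Eq.trans ?_ (hout (1, i))
    rw [← Set.ncard_image_of_injective (T i (i + 1)) (Prod.mk_left_injective (i + 1))]
    congr 1
    ext ⟨g, j⟩
    simp only [Set.mem_image, Prod.mk.injEq, Set.mem_ofPred_eq, harc, mul_one]
    have hj : j = i ∨ j = i + 1 := by
      revert i j
      decide
    constructor
    · rintro ⟨t, ht, rfl, rfl⟩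
      exact ht
    · intro hg
      rcases hj with rfl | rfl
      · exact absurd hg (hloop _ _)
      · exact ⟨g, hg, rfl, rfl⟩
  have h01 : (T 0 1).ncard = 2 := hncard 0
  have h10 : (T 1 0).ncard = 2 := hncard 1
  have hcompl : T 1 0 = (T 0 1)ᶜ := by
    refine Set.eq_of_subset_of_ncard_le (fun g hg hg' => ?_) ?_ (Set.toFinite _)
    · exact hor (1, 0) (g, 1) ((harc _ _ _ _).2 (by simpa using hg'))
        ((harc _ _ _ _).2 (by simpa using hg))
    · rw [Set.ncard_compl, hcard, h01, h10]
  obtain ⟨p, q, hpq, hT⟩ := Set.ncard_eq_two.1 h01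
  have hz : ∀ g, q * p * g ∈ T 0 1 ↔ g ∈ T 0 1 := by
    have himp : ∀ g, g ∈ T 0 1 → q * p * g ∈ T 0 1 := by
      intro g hg
      rw [hT] at hg ⊢
      rcases hg with rfl | rfl
      · right
        simp [mul_assoc, hsq]
      · left
        rw [hcomm, ← mul_assoc, hsq, one_mul]
    refine fun g => ⟨fun hg => ?_, himp g⟩
    simpa [← mul_assoc, hsq, mul_assoc (q * p)] using himp _ hg
  have hz' : ∀ g, q * p * g ∈ T 1 0 ↔ g ∈ T 1 0 := by
    intro g
    simp [hcompl, hz]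
  let σ : Equiv.Perm (G × ZMod 2) := layerStep (fun i => if i = 0 then 1 else q * p) 0
  have h0 : ∀ g : G, σ (g, 0) = (g, 0) := fun g => by simp [σ, layerStep_apply]
  have h1 : ∀ g : G, σ (g, 1) = (q * p * g, 1) := fun g => by simp [σ, layerStep_apply]
  have hσ : IsDigraphAuto (mCayleyArc T) σ := by
    rintro ⟨g, i⟩ ⟨h, j⟩
    rcases zmod_two_cases i with rfl | rfl <;> rcases zmod_two_cases j with rfl | rfl <;>
      simp only [h0, h1, harc, hloop]
    · rw [mul_assoc, hz]
    · rw [hcomm h, mul_assoc, hz', hcomm g]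
  obtain ⟨h, hσh⟩ := (haut σ).1 hσ
  rw [hσh] at h0 h1
  have hh : (1 : G) * h = 1 := congrArg Prod.fst (h0 1)
  have hh' : (1 : G) * h = q * p * 1 := congrArg Prod.fst (h1 1)
  rw [hh, mul_one] at hh'
  exact hpq (mul_left_cancel ((hsq q).trans hh')).symm

theorem ne_one_of_not_isCyclic {a b : G} (hnc : ¬ IsCyclic G)
    (hgen : Subgroup.closure {a, b} = ⊤) : a ≠ 1 ∧ b ≠ 1 ∧ a ≠ b := by
  have hcyc : ∀ g : G, Subgroup.closure {g} ≠ ⊤ := fun g hg =>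
    hnc ⟨g, fun x => by
      change x ∈ Subgroup.zpowers g
      rw [Subgroup.zpowers_eq_closure, hg]
      exact Subgroup.mem_top x⟩
  refine ⟨?_, ?_, ?_⟩ <;> rintro rfl
  · exact hcyc b (by rwa [Subgroup.closure_insert_one] at hgen)
  · exact hcyc a (by rwa [Set.pair_comm, Subgroup.closure_insert_one] at hgen)
  · exact hcyc a (by simpa using hgen)

theorem nonempty_mulEquiv_klein {a b : G} (hnc : ¬ IsCyclic G)
    (hgen : Subgroup.closure {a, b} = ⊤) (ha : a * a = 1) (hb : b * b = 1)
    (hcomm : a * b = b * a) : Nonempty (G ≃* Multiplicative (ZMod 2 × ZMod 2)) := by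
  obtain ⟨ha1, hb1, hab⟩ := ne_one_of_not_isCyclic hnc hgen
  have haa : ∀ g, a * (a * g) = g := fun g => by rw [← mul_assoc, ha, one_mul]
  have hba : ∀ g, b * (a * g) = a * (b * g) := fun g => by rw [← mul_assoc, ← hcomm, mul_assoc]
  have hainv : a⁻¹ = a := inv_eq_of_mul_eq_one_left ha
  have hbinv : b⁻¹ = b := inv_eq_of_mul_eq_one_left hb
  have hall : ∀ g : G, g = 1 ∨ g = a ∨ g = b ∨ g = a * b := by
    intro g
    have hg : g ∈ Subgroup.closure {a, b} := hgen ▸ Subgroup.mem_top g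
    induction hg using Subgroup.closure_induction with
    | mem g hg => rcases hg with rfl | rfl <;> simp
    | one => simp
    | mul g h _ _ hg hh =>
      rcases hg with rfl | rfl | rfl | rfl <;> rcases hh with rfl | rfl | rfl | rfl <;>
        simp [mul_assoc, ha, hb, haa, hba, ← hcomm]
    | inv g _ hg => rcases hg with rfl | rfl | rfl | rfl <;> simp [hainv, hbinv, ← hcomm]
  have hsq : ∀ g : G, g * g = 1 := by
    intro g
    rcases hall g with rfl | rfl | rfl | rfl <;> simp [mul_assoc, ha, hb, hba]
  have hab1 : a * b ≠ 1 := fun h => hab (by rw [← hbinv, eq_inv_of_mul_eq_one_left h])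
  have : Nontrivial G := ⟨a, 1, ha1⟩
  have hklein : IsKleinFour G := by
    refine ⟨?_, Monoid.exponent_eq_prime_iff Nat.prime_two |>.2 fun g hg => ?_⟩
    · classical
      have huniv : (Set.univ : Set G) = ({1, a, b, a * b} : Finset G) := by
        ext g
        simpa using hall g
      rw [← Set.ncard_univ, huniv, Set.ncard_coe_finset]
      simp [Finset.card_insert_of_notMem, ha1.symm, hb1.symm, hab, hab1.symm, ha1, hb1]
    · exact orderOf_eq_prime (by rw [pow_two, hsq]) hg
  exact IsKleinFour.nonempty_mulEquiv

theorem closure_mul_pair {a b : G} (hgen : Subgroup.closure {a, b} = ⊤) :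
    Subgroup.closure {a * b, b} = ⊤ := by
  rw [eq_top_iff, ← hgen, Subgroup.closure_le]
  have hab : a * b ∈ Subgroup.closure {a * b, b} := Subgroup.subset_closure (by simp)
  have hb : b ∈ Subgroup.closure {a * b, b} := Subgroup.subset_closure (by simp)
  rintro x (rfl | rfl)
  · simpa using mul_mem hab (inv_mem hb)
  · exact hb

theorem hasOmSRValencyTwo_two {a b : G} (hnc : ¬ IsCyclic G)
    (hgen : Subgroup.closure {a, b} = ⊤)
    (hklein : ¬ Nonempty (G ≃* Multiplicative (ZMod 2 × ZMod 2))) : HasOmSRValencyTwo G 2 := by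
  have hgen' : Subgroup.closure {b, a} = ⊤ := by rwa [Set.pair_comm]
  by_cases hcomm : a * b = b * a
  · have hmain : ∀ c d : G, Subgroup.closure {c, d} = ⊤ → c * c ≠ 1 → d * d ≠ 1 →
        HasOmSRValencyTwo G 2 := by
      intro c d hcd hc hd
      obtain ⟨h1, h2, h3⟩ := ne_one_of_not_isCyclic hnc hcd
      exact hasOmSRValencyTwo_of_generators le_rfl hcd h1 h2 h3 fun _ => ⟨hc, hd⟩
    have hsq : a * b * (a * b) = a * a * (b * b) := by
      rw [mul_assoc, ← mul_assoc b, ← hcomm, mul_assoc, mul_assoc]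
    by_cases ha : a * a = 1 <;> by_cases hb : b * b = 1
    · exact absurd (nonempty_mulEquiv_klein hnc hgen ha hb hcomm) hklein
    · exact hmain _ _ (closure_mul_pair hgen) (by rwa [hsq, ha, one_mul]) hb
    · refine hmain _ _ (closure_mul_pair hgen') ?_ ha
      rwa [← hcomm, hsq, hb, mul_one]
    · exact hmain a b hgen ha hb
  · by_cases ha : a * a = 1
    · by_cases hb : b * b = 1
      · refine hasOmSRValencyTwo_two_of_not_commute (closure_mul_pair hgen) (fun h => hcomm ?_) ?_
        · calc a * b = (a * b)⁻¹ := eq_inv_of_mul_eq_one_left h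
            _ = b * a := by
              rw [mul_inv_rev, ← eq_inv_of_mul_eq_one_left ha, ← eq_inv_of_mul_eq_one_left hb]
        · rw [mul_assoc, hb, mul_one, ← mul_assoc]
          intro h
          apply hcomm
          calc a * b = b * a * b * b := by rw [← h]
            _ = b * a := by rw [mul_assoc, hb, mul_one]
      · exact hasOmSRValencyTwo_two_of_not_commute hgen' hb (Ne.symm hcomm)
    · exact hasOmSRValencyTwo_two_of_not_commute hgen ha hcomm

end TwoLayers

/-- Lemma 3.2: a finite non-cyclic group generated by two elements has an OmSR
of valency two for every `m ≥ 2`, except when `m = 2` and `G ≅ Z_2 × Z_2`. -/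
theorem noncyclic_two_generated_omsr_valency_two
    (G : Type*) [Group G] [Fintype G] (hnc : ¬ IsCyclic G)
    (hgen : ∃ a b : G, Subgroup.closure {a, b} = ⊤)
    (m : ℕ) (hm : 2 ≤ m) :
    HasOmSRValencyTwo G m ↔
      ¬ (m = 2 ∧ Nonempty (G ≃* Multiplicative (ZMod 2 × ZMod 2))) := by
  obtain ⟨a, b, hgen⟩ := hgen
  constructor
  · rintro h ⟨rfl, ⟨e⟩⟩
    exact not_hasOmSRValencyTwo_two e h
  · intro h
    by_cases hm2 : m = 2
    · subst hm2
      exact hasOmSRValencyTwo_two hnc hgen fun hk => h ⟨rfl, hk⟩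
    · obtain ⟨h1, h2, h3⟩ := ne_one_of_not_isCyclic hnc hgen
      exact hasOmSRValencyTwo_of_generators hm hgen h1 h2 h3 fun h' => absurd h' hm2
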